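/- arXiv:1906.08844 — 2 statements merged into one kernel-verified Lean document; each statement's English description precedes it below -/
import Mathlib

section
/- Let V be a type and d : V → V → ℕ a distance function (d v v = 0, d symmetric, and d satisfying the triangle inequality). Let v₀, v₁, …, v_m be a closed walk (v_m = v₀) of total duration ∑_{s<m} d(v_s, v_{s+1}) = T with T > 0, and let i, j ∈ V satisfy 2 · d(i, j) = T. Then the number of indices s < m with (v_s, v_{s+1}) = (i, j) is at most 1. That is, when the distance between a pair of nodes equals half the schedule length, the service between these nodes can occur at most once in each schedule. -/
/-- The triangle inequality along a walk. -/
theorem le_sum_Ico_of_triangle {V : Type*} (d : V → V → ℕ)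
    (hrefl : ∀ v, d v v = 0) (htri : ∀ u v w, d u w ≤ d u v + d v w)
    (v : ℕ → V) {a b : ℕ} (hab : a ≤ b) :
    d (v a) (v b) ≤ ∑ s ∈ Finset.Ico a b, d (v s) (v (s + 1)) := by
  induction b, hab using Nat.le_induction with
  | base => simp [hrefl]
  | succ b hab ih =>
    rw [Finset.sum_Ico_succ_top hab]
    exact (htri _ (v b) _).trans (Nat.add_le_add_right ih _)

/-- A walk with two distinct traversals of `(i, j)` lasts at least as long as these two
traversals together with a return from `j` to `i`. -/
theorem two_traversals_le_sum_range {V : Type*} (d : V → V → ℕ)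
    (hrefl : ∀ v, d v v = 0) (htri : ∀ u v w, d u w ≤ d u v + d v w)
    (v : ℕ → V) {m a b : ℕ} {i j : V} (hab : a < b) (hbm : b < m)
    (ha : v a = i ∧ v (a + 1) = j) (hb : v b = i ∧ v (b + 1) = j) :
    d i j + d j i + d i j ≤ ∑ s ∈ Finset.range m, d (v s) (v (s + 1)) := by
  have hreturn := le_sum_Ico_of_triangle d hrefl htri v (Nat.succ_le_of_lt hab)
  have hsub : Finset.Ico a (b + 1) ⊆ Finset.range m := fun s hs => by
    simp only [Finset.mem_Ico, Finset.mem_range] at hs ⊢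
    omega
  have hle := Finset.sum_le_sum_of_subset (f := fun s => d (v s) (v (s + 1))) hsub
  rw [Finset.sum_Ico_succ_top hab.le, Finset.sum_eq_sum_Ico_succ_bot hab] at hle
  simp only [Nat.succ_eq_add_one, ha.1, ha.2, hb.1, hb.2] at hreturn hle
  omega


/-- If the distance between `i` and `j` equals half the schedule length `T`, then a
closed walk of total duration `T` traverses the step `(i, j)` at most once. -/
theorem step_at_most_once_of_half_length {V : Type*} [DecidableEq V] (d : V → V → ℕ)
    (hrefl : ∀ v, d v v = 0)
    (hsymm : ∀ u v, d u v = d v u)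
    (htri : ∀ u v w, d u w ≤ d u v + d v w)
    (m : ℕ) (v : ℕ → V) (hclosed : v m = v 0)
    (T : ℕ) (hdur : ∑ s ∈ Finset.range m, d (v s) (v (s + 1)) = T)
    (hT : 0 < T) (i j : V) (hhalf : 2 * d i j = T) :
    ((Finset.range m).filter (fun s => v s = i ∧ v (s + 1) = j)).card ≤ 1 := by
  have hlt : ∀ a b, a < b → b < m → (v a = i ∧ v (a + 1) = j) →
      ¬ (v b = i ∧ v (b + 1) = j) := fun a b hab hbm ha hb => by
    have hle := two_traversals_le_sum_range d hrefl htri v hab hbm ha hb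
    have hji := hsymm j i
    omega
  refine Finset.card_le_one.2 fun a ha b hb => ?_
  simp only [Finset.mem_filter, Finset.mem_range] at ha hb
  rcases lt_trichotomy a b with hab | hab | hab
  · exact (hlt a b hab hb.1 ha.2 hb.2).elim
  · exact hab
  · exact (hlt b a hab ha.1 hb.2 ha.2).elim
end

section
/- Let T be a positive integer, n a positive natural number, and a, b : ℕ → ℤ such that for all s < n: a(s) ≤ b(s); for all s with s + 1 < n: b(s) ≤ a(s+1); and b(n−1) ≤ a(0) + T. Then for any s ≠ s' with s < n and s' < n, the images of the integer intervals [a(s), b(s)) and [a(s'), b(s')) under the reduction map x ↦ x mod T (nonnegative residue modulo T) are disjoint. In particular, a chain of consecutive busy intervals fitting inside a window of length T occupies pairwise disjoint sets of periods of the cyclic schedule, so a single asset can execute all of them within one cycle of length T. -/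
theorem disjoint_image_emod_Ico {T a b c d : ℤ} (hbc : b ≤ c) (hda : d ≤ a + T) :
    Disjoint ((fun x => x % T) '' Set.Ico a b) ((fun x => x % T) '' Set.Ico c d) := by
  rw [Set.disjoint_left]
  rintro _ ⟨x, ⟨hax, hxb⟩, rfl⟩ ⟨y, ⟨hcy, hyd⟩, hxy⟩
  have hdvd : T ∣ y - x := (Int.ModEq.dvd (show x ≡ y [ZMOD T] from hxy.symm))
  have hle := Int.le_of_dvd (by omega) hdvd
  omega

theorem chain_end_le_start {n : ℕ} {a b : ℕ → ℤ} (hab : ∀ s, s < n → a s ≤ b s)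
    (hchain : ∀ s, s + 1 < n → b s ≤ a (s + 1)) {s t : ℕ} (hst : s < t) (ht : t < n) :
    b s ≤ a t := by
  induction t, hst using Nat.le_induction with
  | base => exact hchain s ht
  | succ t _ ih =>
    exact (ih (by omega)).trans ((hab t (by omega)).trans (hchain t ht))

/-- A chain of consecutive busy intervals fitting inside a window of length `T`
occupies pairwise disjoint sets of periods of the cyclic schedule of length `T`. -/
theorem chain_intervals_disjoint_mod (T : ℤ) (hT : 0 < T) (n : ℕ) (hn : 0 < n)
    (a b : ℕ → ℤ)
    (hab : ∀ s, s < n → a s ≤ b s)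
    (hchain : ∀ s, s + 1 < n → b s ≤ a (s + 1))
    (hwrap : b (n - 1) ≤ a 0 + T) :
    ∀ s s', s < n → s' < n → s ≠ s' →
      Disjoint ((fun x => x % T) '' Set.Ico (a s) (b s))
        ((fun x => x % T) '' Set.Ico (a s') (b s')) := by
  have first_le : ∀ s, s < n → a 0 ≤ a s := by
    intro s hs
    rcases Nat.eq_zero_or_pos s with rfl | h
    · exact le_rfl
    · exact (hab 0 hn).trans (chain_end_le_start hab hchain h hs)
  have le_last : ∀ s, s < n → b s ≤ b (n - 1) := by
    intro s hs
    rcases eq_or_lt_of_le (Nat.le_sub_one_of_lt hs) with rfl | h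
    · exact le_rfl
    · exact (chain_end_le_start hab hchain h (by omega)).trans (hab (n - 1) (by omega))
  have disjoint_of_lt : ∀ s t, s < t → t < n →
      Disjoint ((fun x => x % T) '' Set.Ico (a s) (b s))
        ((fun x => x % T) '' Set.Ico (a t) (b t)) := by
    intro s t hst ht
    have h₁ := first_le s (hst.trans ht)
    have h₂ := le_last t ht
    exact disjoint_image_emod_Ico (chain_end_le_start hab hchain hst ht) (by omega)
  intro s s' hs hs' hne
  rcases lt_or_gt_of_ne hne with h | h
  · exact disjoint_of_lt s s' h hs'
  · exact (disjoint_of_lt s' s h hs).symm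
end
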